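/- For every measurable f : ℝ^n → [0,1] and every t > 0, E_{Y∼γ_n}[ w₁(f_{t,Y}) ] ≥ (e^{2t} − 1) Var(P_t f). -/

import Mathlib

open MeasureTheory Real

noncomputable def gauss (n : ℕ) : Measure (Fin n → ℝ) :=
  Measure.pi fun _ => ProbabilityTheory.gaussianReal 0 1

/-- Expectation with respect to the standard Gaussian measure on `ℝ^n`. -/
noncomputable def gExp (n : ℕ) (f : (Fin n → ℝ) → ℝ) : ℝ := ∫ x, f x ∂(gauss n)

/-- Covariance with respect to the standard Gaussian measure on `ℝ^n`. -/
noncomputable def gCov (n : ℕ) (f g : (Fin n → ℝ) → ℝ) : ℝ :=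
  gExp n (fun x => (f x - gExp n f) * (g x - gExp n g))

/-- Variance with respect to the standard Gaussian measure on `ℝ^n`. -/
noncomputable def gVar (n : ℕ) (f : (Fin n → ℝ) → ℝ) : ℝ := gCov n f f

/-- A half-space `{x : ⟨x, a⟩ ≤ b}` in `ℝ^n`. -/
def IsHalfspace {n : ℕ} (A : Set (Fin n → ℝ)) : Prop :=
  ∃ (a : Fin n → ℝ) (b : ℝ), A = {x | ∑ i, x i * a i ≤ b}

/-- The Ornstein--Uhlenbeck semigroup `P_t`. -/
noncomputable def ou (n : ℕ) (t : ℝ) (f : (Fin n → ℝ) → ℝ) : (Fin n → ℝ) → ℝ :=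
  fun x => ∫ y, f (fun i => Real.exp (-t) * x i + Real.sqrt (1 - Real.exp (-2*t)) * y i)
    ∂(gauss n)

/-- The shifted/rescaled function `f_{t,y}(x) = f(√(1-e^{-2t}) x + e^{-t} y)`. -/
noncomputable def shift (n : ℕ) (f : (Fin n → ℝ) → ℝ) (t : ℝ) (y : Fin n → ℝ) :
    (Fin n → ℝ) → ℝ :=
  fun x => f (fun i => Real.sqrt (1 - Real.exp (-2*t)) * x i + Real.exp (-t) * y i)

/-- `M(g)`: the supremum over half-spaces `A` of `Cov(g, 1_A)`. -/
noncomputable def Mg (n : ℕ) (g : (Fin n → ℝ) → ℝ) : ℝ :=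
  ⨆ A : {A : Set (Fin n → ℝ) // IsHalfspace A}, gCov n g (Set.indicator A.1 1)

/-- `w₁(f) = Σ_i (E[X_i f(X)])²`. -/
noncomputable def w1g (n : ℕ) (f : (Fin n → ℝ) → ℝ) : ℝ :=
  ∑ i : Fin n, (gExp n (fun x => x i * f x)) ^ 2


lemma aux_int_bdd {α : Type*} [MeasurableSpace α] (μ : Measure α) [IsFiniteMeasure μ] {f : α → ℝ}
    (hf : Measurable f) {C : ℝ} (hC : ∀ x, |f x| ≤ C) : Integrable f μ :=
  Integrable.of_bound hf.aestronglyMeasurable C (Filter.Eventually.of_forall hC)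

lemma aux_abs_integral_le {α : Type*} [MeasurableSpace α] (μ : Measure α) [IsProbabilityMeasure μ]
    {f : α → ℝ} {C : ℝ} (hC : ∀ x, |f x| ≤ C) : |∫ x, f x ∂μ| ≤ C := by
  have := norm_integral_le_of_norm_le_const (μ := μ) (f := f) (C := C) (Filter.Eventually.of_forall hC)
  simpa using this

lemma aux_sq_le {a C : ℝ} (h : |a| ≤ C) : |a ^ 2| ≤ C ^ 2 := by
  rw [abs_pow]; exact pow_le_pow_left₀ (abs_nonneg _) h 2

lemma aux_mul_le {a b C D : ℝ} (h : |a| ≤ C) (h' : |b| ≤ D) : |a * b| ≤ C * D := by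
  rw [abs_mul]; exact mul_le_mul h h' (abs_nonneg _) ((abs_nonneg _).trans h)

lemma aux_expand {Ω : Type*} [MeasurableSpace Ω] (μ : Measure Ω) [IsProbabilityMeasure μ]
    (g a b : Ω → ℝ) (m : ℝ) (ig : Integrable g μ) (ia : Integrable a μ) (ib : Integrable b μ)
    (ig2 : Integrable (fun z => g z ^ 2) μ) (ia2 : Integrable (fun z => a z ^ 2) μ)
    (ib2 : Integrable (fun z => b z ^ 2) μ) (iga : Integrable (fun z => g z * a z) μ)
    (igb : Integrable (fun z => g z * b z) μ) (iab : Integrable (fun z => a z * b z) μ) :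
    0 ≤ (∫ z, g z ^ 2 ∂μ) + (∫ z, a z ^ 2 ∂μ) + (∫ z, b z ^ 2 ∂μ) + m ^ 2
      - 2 * (∫ z, g z * a z ∂μ) - 2 * (∫ z, g z * b z ∂μ) + 2 * m * (∫ z, g z ∂μ)
      + 2 * (∫ z, a z * b z ∂μ) - 2 * m * (∫ z, a z ∂μ) - 2 * m * (∫ z, b z ∂μ) := by
  have key : 0 ≤ ∫ z, (g z - a z - b z + m) ^ 2 ∂μ :=
    integral_nonneg fun z => sq_nonneg _
  have ex : ∀ z, (g z - a z - b z + m) ^ 2 =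
      g z ^ 2 + a z ^ 2 + b z ^ 2 + m ^ 2 - 2 * (g z * a z) - 2 * (g z * b z)
       + 2 * m * g z + 2 * (a z * b z) - 2 * m * a z - 2 * m * b z := fun z => by ring
  have i1 := iga.const_mul 2
  have i2 := igb.const_mul 2
  have i3 := ig.const_mul (2 * m)
  have i4 := iab.const_mul 2
  have i5 := ia.const_mul (2 * m)
  have i6 := ib.const_mul (2 * m)
  have i0 : Integrable (fun _ : Ω => m ^ 2) μ := integrable_const _
  have k1 := ig2.add ia2
  have k2 := k1.add ib2
  have k3 := k2.add i0
  have k4 := k3.sub i1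
  have k5 := k4.sub i2
  have k6 := k5.add i3
  have k7 := k6.add i4
  have k8 := k7.sub i5
  simp only [Pi.add_def, Pi.sub_def] at k1 k2 k3 k4 k5 k6 k7 k8
  simp_rw [ex] at key
  rw [integral_sub k8 i6, integral_sub k7 i5, integral_add k6 i4, integral_add k5 i3,
    integral_sub k4 i2, integral_sub k3 i1, integral_add k2 i0, integral_add k1 ib2,
    integral_add ig2 ia2] at key
  simp only [integral_const_mul] at key
  simpa using key

/-- two-factor Efron–Stein -/
lemma aux_var_prod {α β : Type*} [MeasurableSpace α] [MeasurableSpace β]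
    (μ : Measure α) (ν : Measure β) [IsProbabilityMeasure μ] [IsProbabilityMeasure ν]
    (g : α × β → ℝ) (hg : Measurable g) (C : ℝ) (hC : ∀ z, |g z| ≤ C) :
    (∫ z, g z ^ 2 ∂(μ.prod ν)) - (∫ z, g z ∂(μ.prod ν)) ^ 2 ≤
      (∫ x, ((∫ y, g (x, y) ^ 2 ∂ν) - (∫ y, g (x, y) ∂ν) ^ 2) ∂μ) +
      (∫ y, ((∫ x, g (x, y) ^ 2 ∂μ) - (∫ x, g (x, y) ∂μ) ^ 2) ∂ν) := by
  set A : α → ℝ := fun x => ∫ y, g (x, y) ∂ν with hA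
  set B : β → ℝ := fun y => ∫ x, g (x, y) ∂μ with hB
  set m := ∫ z, g z ∂(μ.prod ν) with hm
  have mA : Measurable A := (hg.stronglyMeasurable.integral_prod_right' (ν := ν)).measurable
  have mB : Measurable B := (hg.stronglyMeasurable.integral_prod_left' (μ := μ)).measurable
  have bA : ∀ x, |A x| ≤ C := fun x => aux_abs_integral_le ν fun y => hC _
  have bB : ∀ x, |B x| ≤ C := fun x => aux_abs_integral_le μ fun y => hC _
  have ig : Integrable g (μ.prod ν) := aux_int_bdd _ hg hC
  have ig2 : Integrable (fun z => g z ^ 2) (μ.prod ν) :=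
    aux_int_bdd _ (hg.pow_const 2) (fun z => aux_sq_le (hC z))
  have mA1 : Measurable fun z : α × β => A z.1 := mA.comp measurable_fst
  have mB1 : Measurable fun z : α × β => B z.2 := mB.comp measurable_snd
  have igA : Integrable (fun z => g z * A z.1) (μ.prod ν) :=
    aux_int_bdd _ (hg.mul mA1) (fun z => aux_mul_le (hC z) (bA _))
  have igB : Integrable (fun z => g z * B z.2) (μ.prod ν) :=
    aux_int_bdd _ (hg.mul mB1) (fun z => aux_mul_le (hC z) (bB _))
  have iAB : Integrable (fun z : α × β => A z.1 * B z.2) (μ.prod ν) :=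
    aux_int_bdd _ (mA1.mul mB1) (fun z => aux_mul_le (bA _) (bB _))
  have iA1 : Integrable (fun z : α × β => A z.1) (μ.prod ν) := aux_int_bdd _ mA1 (fun z => bA _)
  have iB1 : Integrable (fun z : α × β => B z.2) (μ.prod ν) := aux_int_bdd _ mB1 (fun z => bB _)
  have iA2 : Integrable (fun z : α × β => A z.1 ^ 2) (μ.prod ν) :=
    aux_int_bdd _ (mA1.pow_const 2) (fun z => aux_sq_le (bA _))
  have iB2 : Integrable (fun z : α × β => B z.2 ^ 2) (μ.prod ν) :=
    aux_int_bdd _ (mB1.pow_const 2) (fun z => aux_sq_le (bB _))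
  have jA2 : Integrable (fun z => A z ^ 2) μ :=
    aux_int_bdd _ (mA.pow_const 2) (fun z => aux_sq_le (bA _))
  have jB2 : Integrable (fun z => B z ^ 2) ν :=
    aux_int_bdd _ (mB.pow_const 2) (fun z => aux_sq_le (bB _))
  have eA : ∫ x, A x ∂μ = m := (integral_prod g ig).symm
  have eB : ∫ x, B x ∂ν = m := (integral_prod_symm g ig).symm
  have eA1 : ∫ z, A z.1 ∂(μ.prod ν) = m := by rw [integral_prod _ iA1]; simp [eA]
  have eB1 : ∫ z, B z.2 ∂(μ.prod ν) = m := by rw [integral_prod _ iB1]; simp [eB]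
  have eA2 : ∫ z, A z.1 ^ 2 ∂(μ.prod ν) = ∫ x, A x ^ 2 ∂μ := by rw [integral_prod _ iA2]; simp
  have eB2 : ∫ z, B z.2 ^ 2 ∂(μ.prod ν) = ∫ x, B x ^ 2 ∂ν := by rw [integral_prod _ iB2]; simp
  have eAB : ∫ z, A z.1 * B z.2 ∂(μ.prod ν) = m * m := by
    rw [integral_prod_mul, eA, eB]
  have egA : ∫ z, g z * A z.1 ∂(μ.prod ν) = ∫ x, A x ^ 2 ∂μ := by
    rw [integral_prod _ igA]; simp_rw [integral_mul_const]; simp [hA, sq]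
  have egB : ∫ z, g z * B z.2 ∂(μ.prod ν) = ∫ x, B x ^ 2 ∂ν := by
    rw [integral_prod_symm _ igB]; simp_rw [integral_mul_const]; simp [hB, sq]
  have r1 : (∫ x, ((∫ y, g (x, y) ^ 2 ∂ν) - A x ^ 2) ∂μ) =
      (∫ z, g z ^ 2 ∂(μ.prod ν)) - ∫ x, A x ^ 2 ∂μ := by
    rw [integral_sub ig2.integral_prod_left jA2, integral_prod _ ig2]
  have r2 : (∫ y, ((∫ x, g (x, y) ^ 2 ∂μ) - B y ^ 2) ∂ν) =
      (∫ z, g z ^ 2 ∂(μ.prod ν)) - ∫ x, B x ^ 2 ∂ν := by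
    rw [integral_sub ig2.integral_prod_right jB2, integral_prod_symm _ ig2]
  rw [r1, r2]
  have key := aux_expand _ g (fun z => A z.1) (fun z => B z.2) m ig iA1 iB1 ig2 iA2 iB2 igA igB iAB
  simp only [eA1, eB1, eA2, eB2, eAB, egA, egB, ← hm] at key
  linarith

lemma aux_cs (h : ℝ → ℝ) (hh : Measurable h) (C : ℝ) (hC : ∀ x, |h x| ≤ C) (a b : ℝ) (hab : a ≤ b) :
    (∫ u in a..b, h u) ^ 2 ≤ (b - a) * ∫ u in a..b, h u ^ 2 := by
  rcases hab.eq_or_lt with rfl | hlt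
  · simp
  have i1 : IntervalIntegrable h volume a b := by
    rw [intervalIntegrable_iff]
    have : IsFiniteMeasure (volume.restrict (Set.uIoc a b)) := ⟨by simp [Set.uIoc]⟩
    exact aux_int_bdd _ hh hC
  have i2 : IntervalIntegrable (fun u => h u ^ 2) volume a b := by
    rw [intervalIntegrable_iff]
    have : IsFiniteMeasure (volume.restrict (Set.uIoc a b)) := ⟨by simp [Set.uIoc]⟩
    exact aux_int_bdd _ (hh.pow_const 2) (fun x => aux_sq_le (hC x))
  set I := ∫ u in a..b, h u with hI
  set m := I / (b - a) with hm
  have key : 0 ≤ ∫ u in a..b, (h u - m) ^ 2 :=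
    intervalIntegral.integral_nonneg hab fun u _ => sq_nonneg _
  have ex : ∀ u, (h u - m) ^ 2 = h u ^ 2 - 2 * m * h u + m ^ 2 := fun u => by ring
  simp_rw [ex] at key
  rw [intervalIntegral.integral_add (i2.sub (i1.const_mul _)) (by simp),
    intervalIntegral.integral_sub i2 (i1.const_mul _), intervalIntegral.integral_const_mul] at key
  simp only [intervalIntegral.integral_const, smul_eq_mul, ← hI] at key
  have hp : 0 < b - a := by linarith
  have e : I = m * (b - a) := by rw [hm]; field_simp
  rw [e] at key ⊢
  nlinarith

open ProbabilityTheory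

lemma aux_pdf (x : ℝ) : gaussianPDFReal 0 1 x = (√(2 * π))⁻¹ * rexp (-x ^ 2 / 2) := by
  simp [gaussianPDFReal]

lemma aux_pdf_deriv (x : ℝ) :
    HasDerivAt (gaussianPDFReal 0 1) (-(x * gaussianPDFReal 0 1 x)) x := by
  have : gaussianPDFReal 0 1 = fun x => (√(2 * π))⁻¹ * rexp (-x ^ 2 / 2) := funext aux_pdf
  rw [this]
  have h1 : HasDerivAt (fun x : ℝ => -x ^ 2 / 2) (-x) x := by
    have := ((hasDerivAt_pow 2 x).neg.div_const 2)
    refine this.congr_deriv ?_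
    norm_num
    ring
  refine (h1.exp.const_mul (√(2 * π))⁻¹).congr_deriv ?_
  ring

lemma aux_integ (f : ℝ → ℝ) :
    ∫ x, f x ∂(gaussianReal 0 1) = ∫ x, f x * gaussianPDFReal 0 1 x := by
  rw [integral_gaussianReal_eq_integral_smul (by simp)]
  simp [mul_comm]

lemma aux_id_int : Integrable (fun x : ℝ => x) (gaussianReal 0 1) :=
  (memLp_id_gaussianReal 1).integrable (by simp)

lemma aux_xpdf_int : Integrable (fun x : ℝ => x * gaussianPDFReal 0 1 x) := by
  have := (integrable_mul_exp_neg_mul_sq (b := 1/2) (by norm_num)).const_mul (√(2 * π))⁻¹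
  refine this.congr (Filter.Eventually.of_forall fun x => ?_)
  simp only [aux_pdf]
  rw [show -(1/2 : ℝ) * x ^ 2 = -x^2/2 by ring]; ring

lemma aux_pdf_cont : Continuous (gaussianPDFReal 0 1) :=
  continuous_iff_continuousAt.2 fun x => (aux_pdf_deriv x).continuousAt

lemma aux_pdf_tendsto : Filter.Tendsto (gaussianPDFReal 0 1) Filter.atTop (nhds 0) := by
  have : gaussianPDFReal 0 1 = fun x => (√(2 * π))⁻¹ * rexp (-x ^ 2 / 2) := funext aux_pdf
  rw [this, ← mul_zero (√(2 * π))⁻¹]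
  refine Filter.Tendsto.const_mul _ (Real.tendsto_exp_atBot.comp ?_)
  refine (Filter.tendsto_neg_atTop_atBot.comp ((Filter.tendsto_pow_atTop two_ne_zero).atTop_div_const (r := (2:ℝ)) two_pos)).congr fun x => ?_
  simp; ring

lemma aux_tail (u : ℝ) : ∫ y in Set.Ici u, y ∂(gaussianReal 0 1) = gaussianPDFReal 0 1 u := by
  rw [← integral_indicator measurableSet_Ici, aux_integ]
  have : ∀ x, (Set.Ici u).indicator (fun y : ℝ => y) x * gaussianPDFReal 0 1 x =
      (Set.Ici u).indicator (fun y : ℝ => y * gaussianPDFReal 0 1 y) x := fun x => by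
    by_cases h : x ∈ Set.Ici u <;> simp [h]
  simp_rw [this]
  rw [integral_indicator measurableSet_Ici, integral_Ici_eq_integral_Ioi]
  have := integral_Ioi_of_hasDerivAt_of_tendsto' (a := u) (f := gaussianPDFReal 0 1)
    (f' := fun x => -(x * gaussianPDFReal 0 1 x)) (fun x _ => aux_pdf_deriv x)
    aux_xpdf_int.neg.integrableOn aux_pdf_tendsto
  rw [integral_neg] at this
  linarith

lemma aux_tail' (u : ℝ) : ∫ y in Set.Iio u, y ∂(gaussianReal 0 1) = -gaussianPDFReal 0 1 u := by
  have := integral_add_compl (measurableSet_Ici (a := u)) aux_id_int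
  rw [aux_tail, integral_id_gaussianReal, Set.compl_Ici] at this
  linarith

/-- kernel -/
noncomputable def auxK (z : ℝ × ℝ) (u : ℝ) : ℝ :=
  if min z.1 z.2 < u ∧ u ≤ max z.1 z.2 then |z.2 - z.1| else 0

lemma auxK_nonneg (z : ℝ × ℝ) (u : ℝ) : 0 ≤ auxK z u := by
  unfold auxK; split_ifs <;> positivity

lemma auxK_meas : Measurable (fun p : (ℝ × ℝ) × ℝ => auxK p.1 p.2) := by
  unfold auxK
  refine Measurable.ite ?_ (by fun_prop) (by fun_prop)
  have m1 : Measurable fun p : (ℝ × ℝ) × ℝ => min p.1.1 p.1.2 := by fun_prop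
  have m2 : Measurable fun p : (ℝ × ℝ) × ℝ => max p.1.1 p.1.2 := by fun_prop
  exact (measurableSet_lt m1 measurable_snd).inter (measurableSet_le measurable_snd m2)

lemma auxK_integrable (u : ℝ) :
    Integrable (fun z => auxK z u) ((gaussianReal 0 1).prod (gaussianReal 0 1)) := by
  have h : Integrable (fun z : ℝ × ℝ => |z.2| + |z.1|) ((gaussianReal 0 1).prod (gaussianReal 0 1)) :=
    (aux_id_int.abs.comp_snd _).add (aux_id_int.abs.comp_fst _)
  refine h.mono' (auxK_meas.comp (measurable_id.prodMk measurable_const)).aestronglyMeasurable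
    (Filter.Eventually.of_forall fun z => ?_)
  rw [Real.norm_of_nonneg (auxK_nonneg _ _)]
  unfold auxK
  split_ifs
  · exact abs_sub _ _
  · positivity

lemma auxK_integral (u : ℝ) :
    ∫ z, auxK z u ∂((gaussianReal 0 1).prod (gaussianReal 0 1)) = 2 * gaussianPDFReal 0 1 u := by
  set γ := gaussianReal 0 1 with hγ
  set L : ℝ → ℝ := (Set.Iio u).indicator 1
  set U : ℝ → ℝ := (Set.Ici u).indicator 1
  set L1 : ℝ → ℝ := (Set.Iio u).indicator (fun x => x)
  set U1 : ℝ → ℝ := (Set.Ici u).indicator (fun x => x)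
  have hK : ∀ z, auxK z u = (L z.1 * U1 z.2 - L1 z.1 * U z.2) + (U1 z.1 * L z.2 - U z.1 * L1 z.2) := by
    rintro ⟨x, y⟩
    simp only [auxK, L, U, L1, U1, Set.indicator_apply, Set.mem_Iio, Set.mem_Ici, Pi.one_apply,
      min_lt_iff, le_max_iff]
    rcases lt_or_ge x u with h1 | h1 <;> rcases lt_or_ge y u with h2 | h2
    · simp [h1, h2, not_le.2 h1, not_le.2 h2]
    · simp [h1, h2, not_lt.2 h2, not_le.2 h1, abs_of_nonneg (show 0 ≤ y - x by linarith)]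
    · simp [h1, h2, not_lt.2 h1, not_le.2 h2, abs_of_nonpos (show y - x ≤ 0 by linarith)]
    · simp [h1, h2, not_lt.2 h1, not_lt.2 h2]
  have iL : Integrable L γ := (integrable_const (1:ℝ)).indicator measurableSet_Iio
  have iU : Integrable U γ := (integrable_const (1:ℝ)).indicator measurableSet_Ici
  have iL1 : Integrable L1 γ := aux_id_int.indicator measurableSet_Iio
  have iU1 : Integrable U1 γ := aux_id_int.indicator measurableSet_Ici
  have eLU : ∫ x, L x ∂γ + ∫ x, U x ∂γ = 1 := by
    rw [← integral_add iL iU]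
    have : ∀ x, L x + U x = 1 := fun x => by
      simp only [L, U, Set.indicator_apply, Set.mem_Iio, Set.mem_Ici, Pi.one_apply]
      rcases lt_or_ge x u with h1 | h1
      · simp [h1]
      · simp [h1, not_lt.2 h1]
    simp [this]
  have eL1 : ∫ x, L1 x ∂γ = -gaussianPDFReal 0 1 u := by
    simp only [L1]; rw [integral_indicator measurableSet_Iio]; exact aux_tail' u
  have eU1 : ∫ x, U1 x ∂γ = gaussianPDFReal 0 1 u := by
    simp only [U1]; rw [integral_indicator measurableSet_Ici]; exact aux_tail u
  simp_rw [hK]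
  have k1 := (iL.mul_prod iU1).sub (iL1.mul_prod iU)
  have k2 := (iU1.mul_prod iL).sub (iU.mul_prod iL1)
  simp only [Pi.sub_def] at k1 k2
  rw [integral_add k1 k2,
    integral_sub (iL.mul_prod iU1) (iL1.mul_prod iU),
    integral_sub (iU1.mul_prod iL) (iU.mul_prod iL1)]
  simp only [integral_prod_mul, eL1, eU1]
  linear_combination (2 * gaussianPDFReal 0 1 u) * eLU

lemma aux_poincare (g h : ℝ → ℝ) (hg : Measurable g) (hh : Measurable h) (C D : ℝ)
    (hC : ∀ x, |g x| ≤ C) (hD : ∀ x, |h x| ≤ D)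
    (hgh : ∀ a b, a ≤ b → g b - g a = ∫ u in a..b, h u) :
    (∫ x, g x ^ 2 ∂(gaussianReal 0 1)) - (∫ x, g x ∂(gaussianReal 0 1)) ^ 2 ≤
      ∫ x, h x ^ 2 ∂(gaussianReal 0 1) := by
  set γ := gaussianReal 0 1 with hγ
  have ig : Integrable g γ := aux_int_bdd _ hg hC
  have ig2 : Integrable (fun z => g z ^ 2) γ :=
    aux_int_bdd _ (hg.pow_const 2) (fun z => aux_sq_le (hC z))
  have ih2 : Integrable (fun z => h z ^ 2) γ :=
    aux_int_bdd _ (hh.pow_const 2) (fun z => aux_sq_le (hD z))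
  have idiff : Integrable (fun z : ℝ × ℝ => (g z.2 - g z.1) ^ 2) (γ.prod γ) :=
    aux_int_bdd _ (by fun_prop) (fun z => aux_sq_le ((abs_sub _ _).trans (add_le_add (hC _) (hC _))))
  have e1 : ∫ z : ℝ × ℝ, (g z.2 - g z.1) ^ 2 ∂(γ.prod γ) =
      2 * ((∫ x, g x ^ 2 ∂γ) - (∫ x, g x ∂γ) ^ 2) := by
    have ex : ∀ z : ℝ × ℝ, (g z.2 - g z.1) ^ 2 = g z.2 ^ 2 + g z.1 ^ 2 - 2 * (g z.1 * g z.2) :=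
      fun z => by ring
    simp_rw [ex]
    have j1 : Integrable (fun z : ℝ × ℝ => g z.2 ^ 2) (γ.prod γ) := ig2.comp_snd γ
    have j2 : Integrable (fun z : ℝ × ℝ => g z.1 ^ 2) (γ.prod γ) := ig2.comp_fst γ
    have j3 := j1.add j2
    simp only [Pi.add_def] at j3
    rw [integral_sub j3 ((ig.mul_prod ig).const_mul 2), integral_add j1 j2, integral_const_mul,
      integral_prod_mul, integral_prod _ j1, integral_prod _ j2]
    simp
    ring
  have hpt : ∀ z : ℝ × ℝ, ENNReal.ofReal ((g z.2 - g z.1) ^ 2) ≤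
      ∫⁻ u, ENNReal.ofReal (auxK z u) * ENNReal.ofReal (h u ^ 2) := by
    intro z
    have e : ∀ u, ENNReal.ofReal (auxK z u) * ENNReal.ofReal (h u ^ 2) =
        (Set.Ioc (min z.1 z.2) (max z.1 z.2)).indicator
          (fun u => ENNReal.ofReal (|z.2 - z.1| * h u ^ 2)) u := fun u => by
      rw [← ENNReal.ofReal_mul (auxK_nonneg _ _), Set.indicator_apply]
      simp only [auxK, Set.mem_Ioc]
      split_ifs <;> simp
    simp_rw [e]
    have fin : IsFiniteMeasure (volume.restrict (Set.Ioc (min z.1 z.2) (max z.1 z.2))) :=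
      ⟨by simp⟩
    rw [lintegral_indicator measurableSet_Ioc, ← ofReal_integral_eq_lintegral_ofReal]
    · apply ENNReal.ofReal_le_ofReal
      rw [integral_const_mul, ← intervalIntegral.integral_of_le min_le_max]
      have cs := aux_cs h hh D hD _ _ (min_le_max (a := z.1) (b := z.2))
      rw [← hgh _ _ min_le_max] at cs
      rcases le_total z.1 z.2 with h1 | h1
      · simpa [h1, abs_of_nonneg (sub_nonneg.2 h1)] using cs
      · rw [abs_of_nonpos (sub_nonpos.2 h1)]
        simp only [min_eq_right h1, max_eq_left h1] at cs ⊢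
        linarith
    · exact (aux_int_bdd _ (hh.pow_const 2) (fun z => aux_sq_le (hD z))).const_mul _
    · exact Filter.Eventually.of_forall fun u => by positivity
  have main : ENNReal.ofReal (2 * ((∫ x, g x ^ 2 ∂γ) - (∫ x, g x ∂γ) ^ 2)) ≤
      ENNReal.ofReal (2 * ∫ x, h x ^ 2 ∂γ) := by
    rw [← e1, ofReal_integral_eq_lintegral_ofReal idiff
      (Filter.Eventually.of_forall fun z => sq_nonneg _)]
    refine (lintegral_mono hpt).trans ?_
    rw [lintegral_lintegral_swap]
    · have inner : ∀ u, ∫⁻ z, ENNReal.ofReal (auxK z u) * ENNReal.ofReal (h u ^ 2) ∂(γ.prod γ) =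
          ENNReal.ofReal (2 * h u ^ 2 * gaussianPDFReal 0 1 u) := fun u => by
        rw [lintegral_mul_const _ (by
          exact (auxK_meas.comp (measurable_id.prodMk measurable_const)).ennreal_ofReal),
          ← ofReal_integral_eq_lintegral_ofReal (auxK_integrable u)
          (Filter.Eventually.of_forall fun z => auxK_nonneg _ _), auxK_integral,
          ← ENNReal.ofReal_mul (by have := gaussianPDFReal_nonneg 0 1 u; positivity)]
        congr 1; ring
      simp_rw [inner]
      rw [← ofReal_integral_eq_lintegral_ofReal, ← aux_integ, integral_const_mul]
      · have : Integrable (fun u => D ^ 2 * 2 * gaussianPDFReal 0 1 u) :=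
          (integrable_gaussianPDFReal 0 1).const_mul _
        refine this.mono' (((hh.pow_const 2).const_mul 2).mul
          (measurable_gaussianPDFReal 0 1)).aestronglyMeasurable
          (Filter.Eventually.of_forall fun u => ?_)
        have hp := gaussianPDFReal_nonneg 0 1 u
        rw [Real.norm_of_nonneg (by positivity)]
        have := aux_sq_le (hD u)
        rw [abs_of_nonneg (sq_nonneg _)] at this
        apply mul_le_mul_of_nonneg_right _ hp
        linarith
      · exact Filter.Eventually.of_forall fun u => by
          have hp := gaussianPDFReal_nonneg 0 1 u
          positivity
    · exact (auxK_meas.ennreal_ofReal.mul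
        ((hh.pow_const 2).comp measurable_snd).ennreal_ofReal).aemeasurable
  have := (ENNReal.ofReal_le_ofReal_iff (mul_nonneg zero_le_two
    (integral_nonneg fun x => sq_nonneg _))).1 main
  linarith

instance aux_prob (n : ℕ) : IsProbabilityMeasure (gauss n) := by unfold gauss; infer_instance

lemma aux_split {n : ℕ} (i : Fin (n + 1)) (F : (Fin (n + 1) → ℝ) → ℝ) :
    ∫ x, F x ∂(gauss (n + 1)) =
      ∫ z : ℝ × (Fin n → ℝ), F (i.insertNth z.1 z.2) ∂((gaussianReal 0 1).prod (gauss n)) := by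
  have := (measurePreserving_piFinSuccAbove (fun _ : Fin (n + 1) => gaussianReal 0 1) i).symm
  exact (this.integral_comp' F).symm

lemma aux_insert_meas {n : ℕ} (i : Fin (n + 1)) :
    Measurable (fun z : ℝ × (Fin n → ℝ) => (i.insertNth z.1 z.2 : Fin (n + 1) → ℝ)) :=
  (MeasurableEquiv.piFinSuccAbove (fun _ : Fin (n + 1) => ℝ) i).symm.measurable

lemma aux_poincare_n (n : ℕ) : ∀ (g : (Fin n → ℝ) → ℝ) (h : Fin n → (Fin n → ℝ) → ℝ) (C D : ℝ),
    Measurable g → (∀ i, Measurable (h i)) → (∀ x, |g x| ≤ C) → (∀ i x, |h i x| ≤ D) →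
    (∀ i x a b, a ≤ b → g (Function.update x i b) - g (Function.update x i a) =
      ∫ u in a..b, h i (Function.update x i u)) →
    (∫ x, g x ^ 2 ∂(gauss n)) - (∫ x, g x ∂(gauss n)) ^ 2 ≤ ∑ i, ∫ x, h i x ^ 2 ∂(gauss n) := by
  induction n with
  | zero =>
    intro g h C D _ _ _ _ _
    have : ∀ x, g x = g default := fun x => by rw [Subsingleton.elim x default]
    simp_rw [this]
    simp
  | succ n ih =>
    intro g h C D mg mh hC hD hgh
    set G : ℝ × (Fin n → ℝ) → ℝ := fun z => g ((0 : Fin (n + 1)).insertNth z.1 z.2) with hG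
    set H : Fin (n + 1) → ℝ × (Fin n → ℝ) → ℝ :=
      fun i z => h i ((0 : Fin (n + 1)).insertNth z.1 z.2) with hH
    have mG : Measurable G := mg.comp (aux_insert_meas 0)
    have mH : ∀ i, Measurable (H i) := fun i => (mh i).comp (aux_insert_meas 0)
    have bH2 : ∀ i z, |H i z ^ 2| ≤ D ^ 2 := fun i z => aux_sq_le (hD _ _)
    have iH2 : ∀ i, Integrable (fun z => H i z ^ 2) ((gaussianReal 0 1).prod (gauss n)) :=
      fun i => aux_int_bdd _ ((mH i).pow_const 2) (bH2 i)
    rw [aux_split 0 (fun x => g x ^ 2), aux_split 0 g, Fin.sum_univ_succ]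
    simp_rw [fun i => aux_split 0 (fun x => h i x ^ 2)]
    refine (aux_var_prod (gaussianReal 0 1) (gauss n) G mG C (fun z => hC _)).trans ?_
    rw [add_comm]
    have mGx : ∀ x, Measurable fun y => G (x, y) := fun x => mG.comp (by fun_prop)
    have mGy : ∀ y, Measurable fun x => G (x, y) := fun x => mG.comp (by fun_prop)
    have mHx : ∀ i x, Measurable fun y => H i (x, y) := fun i x => (mH i).comp (by fun_prop)
    have mHy : ∀ i y, Measurable fun x => H i (x, y) := fun i x => (mH i).comp (by fun_prop)
    have mG2 : Measurable fun z => G z ^ 2 := mG.pow_const 2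
    refine add_le_add ?_ ?_
    · rw [integral_prod_symm _ (iH2 0)]
      refine integral_mono ?_ (iH2 0).integral_prod_right fun y => ?_
      · refine (aux_int_bdd _ mG2 (fun z => aux_sq_le (hC _))).integral_prod_right.sub ?_
        exact aux_int_bdd _ ((mG.stronglyMeasurable.integral_prod_left'
          (μ := gaussianReal 0 1)).measurable.pow_const 2)
          (fun y => aux_sq_le (aux_abs_integral_le _ fun x => hC _))
      · refine aux_poincare (fun x => G (x, y)) (fun x => H 0 (x, y)) (mGy y) (mHy 0 y) C D
          (fun x => hC _) (fun x => hD _ _) fun a b hab => ?_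
        have := hgh 0 (Fin.cons 0 y) a b hab
        simpa [hG, hH] using this
    · rw [Finset.sum_congr rfl (fun i _ => integral_prod _ (iH2 i.succ)),
        ← integral_finsetSum _ (fun i _ => (iH2 i.succ).integral_prod_left)]
      refine integral_mono ?_ (integrable_finsetSum _
        (fun i _ => (iH2 i.succ).integral_prod_left)) fun x => ?_
      · refine (aux_int_bdd _ mG2 (fun z => aux_sq_le (hC _))).integral_prod_left.sub ?_
        exact aux_int_bdd _ ((mG.stronglyMeasurable.integral_prod_right'
          (ν := gauss n)).measurable.pow_const 2)
          (fun y => aux_sq_le (aux_abs_integral_le _ fun x => hC _))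
      · refine ih (fun y => G (x, y)) (fun i y => H i.succ (x, y)) C D (mGx x)
          (fun i => mHx i.succ x) (fun y => hC _) (fun i y => hD _ _) fun i y a b hab => ?_
        have := hgh i.succ (Fin.cons x y) a b hab
        simpa [hG, hH, Fin.cons_update] using this

lemma aux_shift_int (F : ℝ → ℝ) (a b s : ℝ) (hb : b ≠ 0) (w : ℝ → ℝ) :
    ∫ x, w x * F (a * s + b * x) ∂(gaussianReal 0 1) =
      ∫ x, w (x - a / b * s) * F (b * x) * gaussianPDFReal 0 1 (x - a / b * s) := by
  rw [aux_integ, ← integral_sub_right_eq_self _ (a / b * s)]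
  congr 1
  ext x
  have : a * s + b * (x - a / b * s) = b * x := by field_simp; ring
  rw [this]

lemma aux_deriv1 (F : ℝ → ℝ) (hF : Measurable F) (hF1 : ∀ x, |F x| ≤ 1) (a b : ℝ) (hb : b ≠ 0)
    (s0 s1 : ℝ) :
    (∫ x, F (a * s1 + b * x) ∂(gaussianReal 0 1)) - (∫ x, F (a * s0 + b * x) ∂(gaussianReal 0 1)) =
      ∫ u in s0..s1, a / b * ∫ x, x * F (a * u + b * x) ∂(gaussianReal 0 1) := by
  set c := a / b with hc
  have e0 : ∀ s, ∫ x, F (a * s + b * x) ∂(gaussianReal 0 1) =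
      ∫ x, F (b * x) * gaussianPDFReal 0 1 (x - c * s) := fun s => by
    have := aux_shift_int F a b s hb (fun _ => 1)
    simpa using this
  have mFb : Measurable fun x => F (b * x) := hF.comp (by fun_prop)
  have ip : ∀ s, Integrable (fun x => F (b * x) * gaussianPDFReal 0 1 (x - c * s)) := fun s => by
    refine Integrable.bdd_mul (c := 1) ((integrable_gaussianPDFReal 0 1).comp_sub_right (c * s))
      mFb.aestronglyMeasurable (Filter.Eventually.of_forall fun x => hF1 _)
  rw [e0, e0, ← integral_sub (ip s1) (ip s0)]
  have e1 : ∀ u, c * ∫ x, x * F (a * u + b * x) ∂(gaussianReal 0 1) =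
      ∫ x, c * ((x - c * u) * F (b * x) * gaussianPDFReal 0 1 (x - c * u)) := fun u => by
    rw [aux_shift_int F a b u hb (fun x => x), integral_const_mul]
  simp_rw [e1]
  have mq : Measurable (gaussianPDFReal 0 1) := measurable_gaussianPDFReal 0 1
  have mJ : Measurable (fun p : ℝ × ℝ =>
      c * ((p.2 - c * p.1) * F (b * p.2) * gaussianPDFReal 0 1 (p.2 - c * p.1))) := by
    have m1 : Measurable fun p : ℝ × ℝ => F (b * p.2) := hF.comp (by fun_prop)
    have m2 : Measurable fun p : ℝ × ℝ => gaussianPDFReal 0 1 (p.2 - c * p.1) :=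
      mq.comp (by fun_prop)
    fun_prop
  have ib : ∀ u, Integrable (fun x =>
      c * ((x - c * u) * F (b * x) * gaussianPDFReal 0 1 (x - c * u))) := fun u => by
    refine Integrable.const_mul ?_ c
    have : Integrable fun x => F (b * x) * ((x - c * u) * gaussianPDFReal 0 1 (x - c * u)) :=
      Integrable.bdd_mul (c := 1) (aux_xpdf_int.comp_sub_right (c * u))
        mFb.aestronglyMeasurable (Filter.Eventually.of_forall fun x => hF1 _)
    refine this.congr (Filter.Eventually.of_forall fun x => ?_)
    simp only; ring
  have fin : IsFiniteMeasure (volume.restrict (Set.uIoc s0 s1)) := ⟨by simp [Set.uIoc]⟩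
  rw [intervalIntegral_integral_swap]
  · congr 1
    ext x
    have hd : ∀ u, HasDerivAt (fun u => F (b * x) * gaussianPDFReal 0 1 (x - c * u))
        (c * ((x - c * u) * F (b * x) * gaussianPDFReal 0 1 (x - c * u))) u := fun u => by
      have h1 : HasDerivAt (fun u => x - c * u) (-c) u := by
        simpa using ((hasDerivAt_id u).const_mul c).const_sub x
      refine (((aux_pdf_deriv (x - c * u)).comp u h1).const_mul (F (b * x))).congr_deriv ?_
      ring
    rw [intervalIntegral.integral_eq_sub_of_hasDerivAt (fun u _ => hd u)]
    apply Continuous.intervalIntegrable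
    have := aux_pdf_cont
    fun_prop
  · change Integrable (fun p : ℝ × ℝ =>
      c * ((p.2 - c * p.1) * F (b * p.2) * gaussianPDFReal 0 1 (p.2 - c * p.1))) _
    rw [integrable_prod_iff mJ.aestronglyMeasurable]
    refine ⟨Filter.Eventually.of_forall fun u => ib u, ?_⟩
    refine Integrable.of_bound (C := |c| * ∫ x, |x * gaussianPDFReal 0 1 x|)
      mJ.aestronglyMeasurable.norm.integral_prod_right' (Filter.Eventually.of_forall fun u => ?_)
    rw [Real.norm_of_nonneg (integral_nonneg fun x => norm_nonneg _),
      ← integral_sub_right_eq_self (fun x => |x * gaussianPDFReal 0 1 x|) (c * u),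
      ← integral_const_mul]
    refine integral_mono (ib u).norm
      ((aux_xpdf_int.abs.comp_sub_right (c * u)).const_mul |c|) fun x => ?_
    simp only [Real.norm_eq_abs, abs_mul]
    have := hF1 (b * x)
    have h2 : 0 ≤ |x - c * u| * |gaussianPDFReal 0 1 (x - c * u)| := by positivity
    nlinarith [mul_le_mul_of_nonneg_left this (mul_nonneg (abs_nonneg c) h2)]

lemma aux_coord_int (n : ℕ) (i : Fin n) : Integrable (fun x : Fin n → ℝ => x i) (gauss n) := by
  have := (measurePreserving_eval (fun _ : Fin n => gaussianReal 0 1) i)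
  exact this.integrable_comp_of_integrable aux_id_int

lemma aux_deriv_n (n : ℕ) (f : (Fin n → ℝ) → ℝ) (hf : Measurable f) (hf1 : ∀ x, |f x| ≤ 1)
    (a b : ℝ) (hb : b ≠ 0) (i : Fin n) (y : Fin n → ℝ) (s0 s1 : ℝ) :
    (∫ x, f (fun j => a * Function.update y i s1 j + b * x j) ∂(gauss n)) -
      (∫ x, f (fun j => a * Function.update y i s0 j + b * x j) ∂(gauss n)) =
      ∫ u in s0..s1, a / b * ∫ x, x i * f (fun j => a * Function.update y i u j + b * x j)
        ∂(gauss n) := by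
  cases n with
  | zero => exact i.elim0
  | succ n =>
    set Q : ℝ → (Fin n → ℝ) → ℝ :=
      fun z w => f (i.insertNth z (fun j => a * y (i.succAbove j) + b * w j)) with hQ
    have mQ : Measurable (fun p : ℝ × (Fin n → ℝ) => Q p.1 p.2) := by
      refine hf.comp ((aux_insert_meas i).comp (f := fun p : ℝ × (Fin n → ℝ) =>
        (p.1, fun j => a * y (i.succAbove j) + b * p.2 j)) ?_)
      fun_prop
    set F : ℝ → ℝ := fun z => ∫ w, Q z w ∂(gauss n) with hF
    have mF : Measurable F := (mQ.stronglyMeasurable.integral_prod_right' (ν := gauss n)).measurable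
    have bF : ∀ z, |F z| ≤ 1 := fun z => aux_abs_integral_le _ fun w => hf1 _
    have hpt : ∀ (s x : ℝ) (w : Fin n → ℝ),
        f (fun j => a * Function.update y i s j + b * (i.insertNth x w : Fin (n + 1) → ℝ) j) =
          Q (a * s + b * x) w := fun s x w => by
      simp only [hQ]
      congr 1
      ext j
      refine Fin.succAboveCases i ?_ (fun k => ?_) j
      · simp
      · simp
    have mQ' : ∀ s, Measurable (fun p : ℝ × (Fin n → ℝ) => Q (a * s + b * p.1) p.2) := fun s =>
      mQ.comp (g := fun p : ℝ × (Fin n → ℝ) => Q p.1 p.2)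
        (f := fun p : ℝ × (Fin n → ℝ) => (a * s + b * p.1, p.2)) (by fun_prop)
    have E0 : ∀ s, ∫ x, f (fun j => a * Function.update y i s j + b * x j) ∂(gauss (n + 1)) =
        ∫ x, F (a * s + b * x) ∂(gaussianReal 0 1) := fun s => by
      rw [aux_split i]
      simp_rw [hpt]
      rw [integral_prod _ (aux_int_bdd _ (mQ' s) (fun p => hf1 _))]
    have E1 : ∀ s, ∫ x, x i * f (fun j => a * Function.update y i s j + b * x j)
          ∂(gauss (n + 1)) =
        ∫ x, x * F (a * s + b * x) ∂(gaussianReal 0 1) := fun s => by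
      rw [aux_split i]
      simp_rw [hpt]
      rw [integral_prod]
      · simp [integral_const_mul, hF]
      · have h1 : Integrable (fun p : ℝ × (Fin n → ℝ) => p.1)
          ((gaussianReal 0 1).prod (gauss n)) := aux_id_int.comp_fst _
        simpa using h1.mul_bdd (c := 1) (mQ' s).aestronglyMeasurable
          (Filter.Eventually.of_forall fun x => hf1 _)
    simp_rw [E0, E1]
    exact aux_deriv1 F mF bF a b hb s0 s1

theorem stmt6 (n : ℕ) (f : (Fin n → ℝ) → ℝ) (t : ℝ) (hf : Measurable f)
    (hrange : ∀ x, f x ∈ Set.Icc (0:ℝ) 1) (ht : 0 < t) :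
    gExp n (fun y => w1g n (shift n f t y)) ≥
      (Real.exp (2*t) - 1) * gVar n (ou n t f) := by
  have hf1 : ∀ x, |f x| ≤ 1 := fun x => by
    rw [abs_of_nonneg (hrange x).1]; exact (hrange x).2
  set a := Real.exp (-t) with ha
  set b := Real.sqrt (1 - Real.exp (-2*t)) with hb
  have hlt : Real.exp (-2*t) < 1 := by rw [← Real.exp_zero]; exact Real.exp_lt_exp.2 (by linarith)
  have hbpos : 0 < b := Real.sqrt_pos.2 (by linarith)
  have hb2 : b ^ 2 = 1 - Real.exp (-2*t) := Real.sq_sqrt (by linarith)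
  have ha2 : a ^ 2 = Real.exp (-2*t) := by rw [ha, ← Real.exp_nat_mul]; congr 1; push_cast; ring
  have hinv : Real.exp (2*t) * a ^ 2 = 1 := by
    rw [ha2, ← Real.exp_add]; simp
  have hc : (Real.exp (2*t) - 1) * (a / b) ^ 2 = 1 := by
    rw [div_pow, mul_div_assoc', div_eq_one_iff_eq (by positivity), hb2, ← ha2]
    linarith
  have hEpos : 0 ≤ Real.exp (2*t) - 1 := by
    have := Real.one_le_exp (show 0 ≤ 2 * t by linarith)
    linarith
  set g := ou n t f with hg
  have hge : ∀ y, g y = ∫ x, f (fun j => a * y j + b * x j) ∂(gauss n) := fun y => rfl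
  set W : Fin n → (Fin n → ℝ) → ℝ :=
    fun i y => ∫ x, x i * f (fun j => a * y j + b * x j) ∂(gauss n) with hW
  have mff : Measurable (fun p : (Fin n → ℝ) × (Fin n → ℝ) => f (fun j => a * p.1 j + b * p.2 j)) :=
    hf.comp (by fun_prop)
  have mg : Measurable g :=
    (mff.stronglyMeasurable.integral_prod_right' (ν := gauss n)).measurable
  have mW : ∀ i, Measurable (W i) := fun i => by
    have : Measurable (fun p : (Fin n → ℝ) × (Fin n → ℝ) =>
      p.2 i * f (fun j => a * p.1 j + b * p.2 j)) := by fun_prop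
    exact (this.stronglyMeasurable.integral_prod_right' (ν := gauss n)).measurable
  have bg : ∀ y, |g y| ≤ 1 := fun y => aux_abs_integral_le _ fun x => hf1 _
  have bW : ∀ i y, |W i y| ≤ ∑ k, ∫ x, |x k| ∂(gauss n) := fun i y => by
    have h1 : |W i y| ≤ ∫ x, |x i| ∂(gauss n) := by
      rw [← Real.norm_eq_abs]
      simp only [hW]
      refine norm_integral_le_of_norm_le (aux_coord_int n i).abs
        (Filter.Eventually.of_forall fun x => ?_)
      rw [norm_mul]
      exact mul_le_of_le_one_right (norm_nonneg _) (hf1 _)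
    exact h1.trans (Finset.single_le_sum (f := fun k => ∫ x, |x k| ∂(gauss n))
      (fun k _ => integral_nonneg fun x => abs_nonneg _) (Finset.mem_univ i))
  have hP := aux_poincare_n n g (fun i y => a / b * W i y) 1
    (|a / b| * ∑ k, ∫ x, |x k| ∂(gauss n)) mg (fun i => (mW i).const_mul _) bg
    (fun i y => aux_mul_le le_rfl (bW i y))
    (fun i y s0 s1 _ => aux_deriv_n n f hf hf1 a b hbpos.ne' i y s0 s1)
  have ig : Integrable g (gauss n) := aux_int_bdd _ mg bg
  have ig2 : Integrable (fun x => g x ^ 2) (gauss n) :=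
    aux_int_bdd _ (mg.pow_const 2) (fun x => aux_sq_le (bg x))
  have hvar : gVar n g = (∫ x, g x ^ 2 ∂(gauss n)) - (∫ x, g x ∂(gauss n)) ^ 2 := by
    unfold gVar gCov gExp
    set m := ∫ x, g x ∂(gauss n) with hm
    have ex : ∀ x, (g x - m) * (g x - m) = g x ^ 2 - 2 * m * g x + m ^ 2 := fun x => by ring
    simp_rw [ex]
    have k := ig2.sub (ig.const_mul (2 * m))
    simp only [Pi.sub_def] at k
    rw [integral_add k (integrable_const _), integral_sub ig2 (ig.const_mul (2 * m)),
      integral_const_mul, ← hm]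
    simp
    ring
  have hw : gExp n (fun y => w1g n (shift n f t y)) = ∑ i, ∫ y, W i y ^ 2 ∂(gauss n) := by
    unfold gExp w1g gExp shift
    rw [← integral_finsetSum _ (fun i _ =>
      aux_int_bdd _ ((mW i).pow_const 2) (fun x => aux_sq_le (bW i x)))]
    simp_rw [hW, add_comm]
    rfl
  rw [hvar, hw, ge_iff_le]
  simp_rw [mul_pow, integral_const_mul] at hP
  rw [← Finset.mul_sum] at hP
  calc _ ≤ _ := mul_le_mul_of_nonneg_left hP hEpos
    _ = _ := by rw [← mul_assoc, hc, one_mul]
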